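/- arXiv:2407.19312 — 2 statements merged into one kernel-verified Lean document; each statement's English description precedes it below -/
import Mathlib

section
/- Let s > 0 and 0 < β ≤ min{s/2, 1}. Then for all positive integers i and j, ∑_{k=1}^∞ (i∧j)^β · (1+|i−j|) / ( (i∧k)^β · (k∧j)^β · (1+|i−k|) · (1+|k−j|) ) · ( w(i,j) / ( w(i,k)·w(k,j) ) )^s ≤ 2^{s/2+3}/β. -/
/-- The weight `w(i,j) = (√(i∧j) + |i−j|)/√(i∧j)` for positive integers `i, j`. -/
noncomputable def w (i j : ℕ+) : ℝ :=
  (Real.sqrt (min (i : ℝ) (j : ℝ)) + |(i : ℝ) - (j : ℝ)|) / Real.sqrt (min (i : ℝ) (j : ℝ))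

namespace KCE

noncomputable def W (i j : ℕ+) : ℝ := Real.sqrt (min (i : ℝ) (j : ℝ)) + |(i : ℝ) - (j : ℝ)|

noncomputable def Q (t : ℝ) (i j k : ℕ+) : ℝ :=
  (1 + |(i : ℝ) - (j : ℝ)|) / ((1 + |(i : ℝ) - (k : ℝ)|) * (1 + |(k : ℝ) - (j : ℝ)|)) *
    (W i j / (W i k * W k j)) ^ t

lemma one_le (i : ℕ+) : (1 : ℝ) ≤ (i : ℝ) := by exact_mod_cast i.one_le

lemma min_cast (i j : ℕ+) : ((min i j : ℕ+) : ℝ) = min (i : ℝ) (j : ℝ) := by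
  rcases le_total i j with h | h
  · have h' : (i : ℝ) ≤ j := by exact_mod_cast h
    rw [min_eq_left h, min_eq_left h']
  · have h' : (j : ℝ) ≤ i := by exact_mod_cast h
    rw [min_eq_right h, min_eq_right h']

lemma one_le_sqrt_min (i j : ℕ+) : 1 ≤ Real.sqrt (min (i : ℝ) (j : ℝ)) := by
  rw [Real.one_le_sqrt]
  exact le_min (one_le i) (one_le j)

lemma W_ge (i j : ℕ+) : 1 + |(i : ℝ) - (j : ℝ)| ≤ W i j := by
  unfold W; linarith [one_le_sqrt_min i j]

lemma W_pos (i j : ℕ+) : 0 < W i j := by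
  have := W_ge i j
  have := abs_nonneg ((i : ℝ) - j)
  linarith

lemma W_comm (i j : ℕ+) : W i j = W j i := by
  unfold W; rw [min_comm, abs_sub_comm]

lemma W_le (i j : ℕ+) (h : i ≤ j) : W i j = Real.sqrt i + ((j : ℝ) - i) := by
  have h' : (i : ℝ) ≤ j := by exact_mod_cast h
  unfold W; rw [min_eq_left h', abs_sub_comm, abs_of_nonneg (by linarith)]

lemma w_eq (i j : ℕ+) : w i j = W i j / Real.sqrt (min (i : ℝ) (j : ℝ)) := rfl

lemma w_comm (i j : ℕ+) : w i j = w j i := by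
  rw [w_eq, w_eq, W_comm, min_comm]

lemma w_pos (i j : ℕ+) : 0 < w i j := by
  rw [w_eq]
  have := one_le_sqrt_min i j
  exact div_pos (W_pos i j) (by linarith)

lemma one_le_w (i j : ℕ+) : 1 ≤ w i j := by
  rw [w_eq, one_le_div (by linarith [one_le_sqrt_min i j])]
  unfold W; linarith [abs_nonneg ((i : ℝ) - j)]

lemma w_le (i j : ℕ+) (h : i ≤ j) : w i j = (Real.sqrt i + ((j : ℝ) - i)) / Real.sqrt i := by
  have h' : (i : ℝ) ≤ j := by exact_mod_cast h
  rw [w_eq, W_le i j h, min_eq_left h']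

lemma sqrt_ge (i : ℕ+) : 1 ≤ Real.sqrt (i : ℝ) := by
  rw [Real.one_le_sqrt]; exact one_le i

/-- sqrt is 1-Lipschitz on positive integers -/
lemma sqrt_lip (i k : ℕ+) (h : k ≤ i) : Real.sqrt i - Real.sqrt k ≤ (i : ℝ) - k := by
  have h' : (k : ℝ) ≤ i := by exact_mod_cast h
  have h1 := sqrt_ge i
  have h2 := sqrt_ge k
  have h3 : Real.sqrt k ≤ Real.sqrt i := Real.sqrt_le_sqrt h'
  have h4 := Real.sq_sqrt (show (0 : ℝ) ≤ i by linarith [one_le i])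
  have h5 := Real.sq_sqrt (show (0 : ℝ) ≤ k by linarith [one_le k])
  nlinarith

lemma sqrt_mono (i k : ℕ+) (h : k ≤ i) : Real.sqrt k ≤ Real.sqrt i :=
  Real.sqrt_le_sqrt (by exact_mod_cast h)

lemma w_submul_aux (i j k : ℕ+) (h : i ≤ j) : w i j ≤ w i k * w k j := by
  have hij : (i : ℝ) ≤ j := by exact_mod_cast h
  have hi := sqrt_ge i
  have hk := sqrt_ge k
  rcases le_total k i with hki | hik
  · have h1 : w i j ≤ w k j := by
      have hki' : (k : ℝ) ≤ i := by exact_mod_cast hki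
      rw [w_le i j h, w_le k j (hki.trans h), div_le_div_iff₀ (by linarith) (by linarith)]
      have := sqrt_mono i k hki
      nlinarith
    have h2 := one_le_w i k
    have h3 := w_pos k j
    nlinarith
  · have hik' : (i : ℝ) ≤ k := by exact_mod_cast hik
    rcases le_total k j with hkj | hjk
    · have hkj' : (k : ℝ) ≤ j := by exact_mod_cast hkj
      rw [w_le i j h, w_le i k hik, w_le k j hkj, div_mul_div_comm,
        div_le_div_iff₀ (by linarith) (by nlinarith)]
      have h1 := sqrt_lip k i hik
      have : (Real.sqrt i + ((j : ℝ) - i)) * Real.sqrt k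
          ≤ (Real.sqrt i + ((k : ℝ) - i)) * (Real.sqrt k + ((j : ℝ) - k)) := by
        nlinarith
      nlinarith
    · have hjk' : (j : ℝ) ≤ k := by exact_mod_cast hjk
      have h1 : w i j ≤ w i k := by
        rw [w_le i j h, w_le i k hik]
        gcongr
      have h2 := one_le_w k j
      have h3 := w_pos i k
      nlinarith

lemma w_submul (i j k : ℕ+) : w i j ≤ w i k * w k j := by
  rcases le_total i j with h | h
  · exact w_submul_aux i j k h
  · have := w_submul_aux j i k h
    rw [w_comm i j, w_comm i k, w_comm k j, mul_comm]
    exact this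

lemma rpow_sqrt {x : ℝ} (hx : 0 ≤ x) (β : ℝ) : x ^ β = (Real.sqrt x) ^ (2 * β) := by
  rw [Real.rpow_mul (Real.sqrt_nonneg x), Real.rpow_two, Real.sq_sqrt hx]

lemma Q_comm (t : ℝ) (i j k : ℕ+) : Q t i j k = Q t j i k := by
  unfold Q
  rw [W_comm i j, W_comm i k, W_comm k j, mul_comm (W k i), abs_sub_comm (i : ℝ) j,
    abs_sub_comm (i : ℝ) k, abs_sub_comm (k : ℝ) j, mul_comm (1 + |(k : ℝ) - i|)]

lemma Q_nonneg (t : ℝ) (i j k : ℕ+) : 0 ≤ Q t i j k := by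
  unfold Q
  have := W_pos i j
  have := W_pos i k
  have := W_pos k j
  positivity

lemma term_nonneg (s β : ℝ) (i j k : ℕ+) : 0 ≤
    ((min i j : ℕ+) : ℝ) ^ β * (1 + |(i : ℝ) - (j : ℝ)|) /
          (((min i k : ℕ+) : ℝ) ^ β * ((min k j : ℕ+) : ℝ) ^ β *
            (1 + |(i : ℝ) - (k : ℝ)|) * (1 + |(k : ℝ) - (j : ℝ)|)) *
        (w i j / (w i k * w k j)) ^ s := by
  have := w_pos i j
  have := w_pos i k
  have := w_pos k j
  positivity

lemma term_le (s β : ℝ) (hβs : 2 * β ≤ s) (i j k : ℕ+) :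
    ((min i j : ℕ+) : ℝ) ^ β * (1 + |(i : ℝ) - (j : ℝ)|) /
          (((min i k : ℕ+) : ℝ) ^ β * ((min k j : ℕ+) : ℝ) ^ β *
            (1 + |(i : ℝ) - (k : ℝ)|) * (1 + |(k : ℝ) - (j : ℝ)|)) *
        (w i j / (w i k * w k j)) ^ s ≤ Q (2 * β) i j k := by
  have h1 := w_pos i j
  have h2 := w_pos i k
  have h3 := w_pos k j
  have hr : (w i j / (w i k * w k j)) ^ s ≤ (w i j / (w i k * w k j)) ^ (2 * β) := by
    apply Real.rpow_le_rpow_of_exponent_ge (by positivity) _ hβs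
    rw [div_le_one (by positivity)]
    exact w_submul i j k
  refine (mul_le_mul_of_nonneg_left hr (by positivity)).trans (le_of_eq ?_)
  have e : ∀ a b : ℕ+, W a b = Real.sqrt (min (a : ℝ) (b : ℝ)) * w a b := by
    intro a b
    have := one_le_sqrt_min a b
    rw [w_eq, mul_div_cancel₀]
    linarith
  have m : ∀ a b : ℕ+, 0 ≤ min (a : ℝ) (b : ℝ) := fun a b =>
    le_min (by linarith [one_le a]) (by linarith [one_le b])
  unfold Q
  rw [min_cast, min_cast, min_cast, rpow_sqrt (m i j), rpow_sqrt (m i k), rpow_sqrt (m k j),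
    e i j, e i k, e k j]
  have s1 := one_le_sqrt_min i j
  have s2 := one_le_sqrt_min i k
  have s3 := one_le_sqrt_min k j
  generalize Real.sqrt (min (i : ℝ) (j : ℝ)) = a at *
  generalize Real.sqrt (min (i : ℝ) (k : ℝ)) = b at *
  generalize Real.sqrt (min (k : ℝ) (j : ℝ)) = c at *
  have a0 : 0 < a := by linarith
  have b0 : 0 < b := by linarith
  have c0 : 0 < c := by linarith
  have hh : a * w i j / (b * w i k * (c * w k j)) = a / (b * c) * (w i j / (w i k * w k j)) := by
    field_simp
  rw [hh, Real.mul_rpow (by positivity) (by positivity),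
    Real.div_rpow a0.le (by positivity), Real.mul_rpow b0.le c0.le]
  have := Real.rpow_pos_of_pos a0 (2 * β)
  have := Real.rpow_pos_of_pos b0 (2 * β)
  have := Real.rpow_pos_of_pos c0 (2 * β)
  field_simp

noncomputable def G (t : ℝ) (m : ℕ) : ℝ := (1 / (1 + (m : ℝ))) ^ (1 + t)

lemma G_nonneg (t : ℝ) (m : ℕ) : 0 ≤ G t m := by unfold G; positivity

lemma Q_le_of (t u : ℝ) (ht : 0 < t) (hu : 0 < u) (i j k : ℕ+)
    (h1 : (1 + |(i : ℝ) - (j : ℝ)|) / ((1 + |(i : ℝ) - (k : ℝ)|) * (1 + |(k : ℝ) - (j : ℝ)|)) ≤ u)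
    (h2 : W i j / (W i k * W k j) ≤ u) : Q t i j k ≤ u ^ (1 + t) := by
  unfold Q
  rw [Real.rpow_add hu, Real.rpow_one]
  have := W_pos i j
  have := W_pos i k
  have := W_pos k j
  gcongr

lemma div_le_aux {a b c u : ℝ} (hb : 0 < b) (hc : 0 < c) (h : a ≤ u * (b * c)) :
    a / (b * c) ≤ u := by
  rw [div_le_iff₀ (by positivity)]; exact h

lemma Q_left (t : ℝ) (ht : 0 < t) (i j k : ℕ+) (hij : i ≤ j) (hk : k ≤ i) :
    Q t i j k ≤ G t ((i : ℕ) - k) := by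
  have hij' : (i : ℝ) ≤ j := by exact_mod_cast hij
  have hk' : (k : ℝ) ≤ i := by exact_mod_cast hk
  have hc : (((i : ℕ) - (k : ℕ) : ℕ) : ℝ) = (i : ℝ) - k := by
    rw [Nat.cast_sub (by exact_mod_cast hk)]
  unfold G
  rw [hc]
  have e1 : |(i : ℝ) - j| = j - i := by rw [abs_sub_comm, abs_of_nonneg (by linarith)]
  have e2 : |(i : ℝ) - k| = i - k := abs_of_nonneg (by linarith)
  have e3 : |(k : ℝ) - j| = j - k := by rw [abs_sub_comm, abs_of_nonneg (by linarith)]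
  have p : (0 : ℝ) < 1 + (i - k) := by linarith
  apply Q_le_of t _ ht (by positivity)
  · rw [e1, e2, e3]
    apply div_le_aux (by linarith) (by linarith)
    field_simp
    linarith
  · apply div_le_aux (W_pos _ _) (W_pos _ _)
    have h1 := W_ge i k
    rw [e2] at h1
    have h2 : W i j ≤ W k j := by
      rw [W_le i j hij, W_le k j (hk.trans hij)]
      linarith [sqrt_lip i k hk]
    rw [← mul_assoc]
    have : 1 ≤ 1 / (1 + ((i : ℝ) - k)) * W i k := by
      rw [one_div, ← div_eq_inv_mul, one_le_div p]; exact h1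
    nlinarith [W_pos k j]

lemma Q_right (t : ℝ) (ht : 0 < t) (i j k : ℕ+) (hij : i ≤ j) (hk : j ≤ k) :
    Q t i j k ≤ G t ((k : ℕ) - j) := by
  have hij' : (i : ℝ) ≤ j := by exact_mod_cast hij
  have hk' : (j : ℝ) ≤ k := by exact_mod_cast hk
  have hc : (((k : ℕ) - (j : ℕ) : ℕ) : ℝ) = (k : ℝ) - j := by
    rw [Nat.cast_sub (by exact_mod_cast hk)]
  unfold G
  rw [hc]
  have e1 : |(i : ℝ) - j| = j - i := by rw [abs_sub_comm, abs_of_nonneg (by linarith)]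
  have e2 : |(i : ℝ) - k| = k - i := by rw [abs_sub_comm, abs_of_nonneg (by linarith)]
  have e3 : |(k : ℝ) - j| = k - j := abs_of_nonneg (by linarith)
  have p : (0 : ℝ) < 1 + (k - j) := by linarith
  apply Q_le_of t _ ht (by positivity)
  · rw [e1, e2, e3]
    apply div_le_aux (by linarith) (by linarith)
    field_simp
    linarith
  · apply div_le_aux (W_pos _ _) (W_pos _ _)
    have h1 := W_ge k j
    rw [e3] at h1
    have h2 : W i j ≤ W i k := by
      rw [W_le i j hij, W_le i k (hij.trans hk)]
      linarith
    rw [mul_comm (W i k), ← mul_assoc]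
    have : 1 ≤ 1 / (1 + ((k : ℝ) - j)) * W k j := by
      rw [one_div, ← div_eq_inv_mul, one_le_div p]; exact h1
    nlinarith [W_pos i k]

lemma mid_aux {a b c d : ℝ} (hd : 0 < d) (hb : d ≤ b) (hc : d ≤ c) (h : a ≤ b + c) :
    a / (b * c) ≤ 2 * (1 / d) := by
  apply div_le_aux (by linarith) (by linarith)
  rw [mul_one_div, div_mul_eq_mul_div, le_div_iff₀ hd]
  nlinarith [mul_nonneg (sub_nonneg.2 hb) (hd.le.trans hc), mul_nonneg (sub_nonneg.2 hc) (hd.le.trans hb)]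

lemma Q_mid (t : ℝ) (ht : 0 < t) (i j k : ℕ+) (hik : i ≤ k) (hkj : k ≤ j) :
    Q t i j k ≤ 2 ^ (1 + t) * G t ((k : ℕ) - i) ∨ Q t i j k ≤ 2 ^ (1 + t) * G t ((j : ℕ) - k) := by
  have hik' : (i : ℝ) ≤ k := by exact_mod_cast hik
  have hkj' : (k : ℝ) ≤ j := by exact_mod_cast hkj
  have c1 : (((k : ℕ) - (i : ℕ) : ℕ) : ℝ) = (k : ℝ) - i := by
    rw [Nat.cast_sub (by exact_mod_cast hik)]
  have c2 : (((j : ℕ) - (k : ℕ) : ℕ) : ℝ) = (j : ℝ) - k := by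
    rw [Nat.cast_sub (by exact_mod_cast hkj)]
  have e1 : |(i : ℝ) - j| = j - i := by rw [abs_sub_comm, abs_of_nonneg (by linarith)]
  have e2 : |(i : ℝ) - k| = k - i := by rw [abs_sub_comm, abs_of_nonneg (by linarith)]
  have e3 : |(k : ℝ) - j| = j - k := by rw [abs_sub_comm, abs_of_nonneg (by linarith)]
  have h1 := W_ge i k
  have h2 := W_ge k j
  have h3 : W i j ≤ W i k + W k j := by
    rw [W_le i j (hik.trans hkj), W_le i k hik, W_le k j hkj]
    linarith [sqrt_ge k]
  unfold G
  rw [c1, c2]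
  have p1 : (0 : ℝ) < 1 + (k - i) := by linarith
  have p2 : (0 : ℝ) < 1 + (j - k) := by linarith
  rw [← Real.mul_rpow (by norm_num) (by positivity), ← Real.mul_rpow (by norm_num) (by positivity)]
  rw [e2] at h1
  rw [e3] at h2
  rcases le_total ((k : ℝ) - i) (j - k) with h | h
  · left
    apply Q_le_of t _ ht (by positivity)
    · rw [e1, e2, e3]
      exact mid_aux p1 (by linarith) (by linarith) (by linarith)
    · exact mid_aux p1 (by linarith) (by linarith) (by linarith)
  · right
    apply Q_le_of t _ ht (by positivity)
    · rw [e1, e2, e3]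
      exact mid_aux p2 (by linarith) (by linarith) (by linarith)
    · exact mid_aux p2 (by linarith) (by linarith) (by linarith)

lemma G_tele (t : ℝ) (ht : 0 < t) (m : ℕ) :
    G t (m + 1) ≤ 1 / t * ((1 + (m : ℝ)) ^ (-t) - (1 + ((m + 1 : ℕ) : ℝ)) ^ (-t)) := by
  have hm : (0 : ℝ) ≤ m := Nat.cast_nonneg m
  unfold G
  push_cast
  set y : ℝ := 1 + ((m : ℝ) + 1) with hy
  have y0 : 0 < y := by linarith
  have hx : 1 + (m : ℝ) = y * (1 - 1 / y) := by field_simp; linarith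
  have hq : 0 < 1 - 1 / y := by
    rw [sub_pos, div_lt_one y0]; linarith
  have h1 : 1 + t / y ≤ (1 - 1 / y) ^ (-t) := by
    rw [Real.rpow_def_of_pos hq]
    have a := Real.log_le_sub_one_of_pos hq
    have b := Real.add_one_le_exp (Real.log (1 - 1 / y) * -t)
    have : t / y = t * (1 / y) := by ring
    nlinarith
  rw [hx, Real.mul_rpow y0.le hq.le, Real.div_rpow (by norm_num) y0.le, Real.one_rpow,
    Real.rpow_add y0, Real.rpow_one, Real.rpow_neg y0.le]
  have z := Real.rpow_pos_of_pos y0 t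
  generalize y ^ t = Z at *
  have : 1 / (y * Z) = 1 / t * (Z⁻¹ * (1 + t / y) - Z⁻¹) := by field_simp; ring
  rw [this]
  gcongr

lemma G_range (t : ℝ) (ht : 0 < t) (n : ℕ) :
    ∑ m ∈ Finset.range n, G t (m + 1) ≤ 1 / t := by
  have : ∑ m ∈ Finset.range n, G t (m + 1) ≤ 1 / t * (1 - (1 + (n : ℝ)) ^ (-t)) := by
    induction n with
    | zero => simp
    | succ n ih =>
      rw [Finset.sum_range_succ]
      have := G_tele t ht n
      linarith
  have h2 : (0 : ℝ) ≤ (1 + (n : ℝ)) ^ (-t) := by positivity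
  refine this.trans ?_
  have : 0 < 1 / t := by positivity
  nlinarith

lemma G_inj (t : ℝ) (ht : 0 < t) (S : Finset ℕ+) (φ : ℕ+ → ℕ) (hφ : Set.InjOn φ S) :
    ∑ k ∈ S, G t (φ k) ≤ 1 + 1 / t := by
  classical
  rw [← Finset.sum_image (f := G t) hφ]
  obtain ⟨n, hn⟩ := (S.image φ).exists_nat_subset_range
  calc _ ≤ ∑ m ∈ Finset.range (n + 1), G t m :=
        Finset.sum_le_sum_of_subset_of_nonneg
          (hn.trans (Finset.range_mono (Nat.le_succ n))) (fun _ _ _ => G_nonneg t _)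
    _ ≤ _ := by
        rw [Finset.sum_range_succ']
        have := G_range t ht n
        have : G t 0 = 1 := by simp [G]
        linarith

lemma G_inj_pos (t : ℝ) (ht : 0 < t) (S : Finset ℕ+) (φ : ℕ+ → ℕ) (hφ : Set.InjOn φ S)
    (hpos : ∀ k ∈ S, 1 ≤ φ k) :
    ∑ k ∈ S, G t (φ k) ≤ 1 / t := by
  classical
  have h : ∑ k ∈ S, G t (φ k) = ∑ k ∈ S, G t ((φ k - 1) + 1) :=
    Finset.sum_congr rfl fun k hk => by rw [Nat.sub_add_cancel (hpos k hk)]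
  have hi : Set.InjOn (fun k => φ k - 1) (S : Set ℕ+) := by
    intro a ha b hb hab
    apply hφ ha hb
    have := hpos a ha
    have := hpos b hb
    simp only at hab
    omega
  rw [h, ← Finset.sum_image (f := fun m => G t (m + 1)) hi]
  obtain ⟨n, hn⟩ := (S.image fun k => φ k - 1).exists_nat_subset_range
  exact (Finset.sum_le_sum_of_subset_of_nonneg hn (fun _ _ _ => G_nonneg t _)).trans
    (G_range t ht n)

noncomputable def gl (t : ℝ) (i k : ℕ+) : ℝ :=
  if k ≤ i then G t ((i : ℕ) - k) else 2 ^ (1 + t) * G t ((k : ℕ) - i)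

noncomputable def gr (t : ℝ) (j k : ℕ+) : ℝ :=
  if j ≤ k then G t ((k : ℕ) - j) else 2 ^ (1 + t) * G t ((j : ℕ) - k)

lemma gl_nonneg (t : ℝ) (i k : ℕ+) : 0 ≤ gl t i k := by
  unfold gl
  have := G_nonneg t
  split_ifs
  · exact this _
  · exact mul_nonneg (by positivity) (this _)

lemma gr_nonneg (t : ℝ) (i k : ℕ+) : 0 ≤ gr t i k := by
  unfold gr
  have := G_nonneg t
  split_ifs
  · exact this _
  · exact mul_nonneg (by positivity) (this _)

lemma gl_sum (t : ℝ) (ht : 0 < t) (i : ℕ+) (S : Finset ℕ+) :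
    ∑ k ∈ S, gl t i k ≤ 1 + 1 / t + 2 ^ (1 + t) * (1 / t) := by
  unfold gl
  rw [Finset.sum_ite, ← Finset.mul_sum]
  gcongr
  · apply G_inj t ht
    intro a ha b hb hab
    simp only [Finset.coe_filter, Set.mem_setOf_eq, ← PNat.coe_le_coe] at ha hb
    apply PNat.eq
    simp only at hab
    omega
  · apply G_inj_pos t ht
    · intro a ha b hb hab
      simp only [Finset.coe_filter, Set.mem_setOf_eq, ← PNat.coe_le_coe] at ha hb
      apply PNat.eq
      simp only at hab
      omega
    · intro a ha
      simp only [Finset.mem_filter, ← PNat.coe_le_coe] at ha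
      omega

lemma gr_sum (t : ℝ) (ht : 0 < t) (i : ℕ+) (S : Finset ℕ+) :
    ∑ k ∈ S, gr t i k ≤ 1 + 1 / t + 2 ^ (1 + t) * (1 / t) := by
  unfold gr
  rw [Finset.sum_ite, ← Finset.mul_sum]
  gcongr
  · apply G_inj t ht
    intro a ha b hb hab
    simp only [Finset.coe_filter, Set.mem_setOf_eq, ← PNat.coe_le_coe] at ha hb
    apply PNat.eq
    simp only at hab
    omega
  · apply G_inj_pos t ht
    · intro a ha b hb hab
      simp only [Finset.coe_filter, Set.mem_setOf_eq, ← PNat.coe_le_coe] at ha hb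
      apply PNat.eq
      simp only at hab
      omega
    · intro a ha
      simp only [Finset.mem_filter, ← PNat.coe_le_coe] at ha
      omega

lemma Q_le (t : ℝ) (ht : 0 < t) (i j k : ℕ+) (hij : i ≤ j) :
    Q t i j k ≤ gl t i k + gr t j k := by
  have a := gl_nonneg t i k
  have b := gr_nonneg t j k
  by_cases h1 : k ≤ i
  · have := Q_left t ht i j k hij h1
    have e : gl t i k = G t ((i : ℕ) - k) := if_pos h1
    linarith
  by_cases h2 : j ≤ k
  · have := Q_right t ht i j k hij h2
    have e : gr t j k = G t ((k : ℕ) - j) := if_pos h2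
    linarith
  have e1 : gl t i k = 2 ^ (1 + t) * G t ((k : ℕ) - i) := if_neg h1
  have e2 : gr t j k = 2 ^ (1 + t) * G t ((j : ℕ) - k) := if_neg h2
  rcases Q_mid t ht i j k (not_le.1 h1).le (not_le.1 h2).le with h | h <;> linarith

lemma Q_sum (t : ℝ) (ht : 0 < t) (i j : ℕ+) (S : Finset ℕ+) :
    ∑ k ∈ S, Q t i j k ≤ 2 * (1 + 1 / t + 2 ^ (1 + t) * (1 / t)) := by
  have key : ∀ i j : ℕ+, i ≤ j →
      ∑ k ∈ S, Q t i j k ≤ 2 * (1 + 1 / t + 2 ^ (1 + t) * (1 / t)) := by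
    intro i j h
    have h1 := Finset.sum_le_sum (fun k (_ : k ∈ S) => Q_le t ht i j k h)
    rw [Finset.sum_add_distrib] at h1
    linarith [gl_sum t ht i S, gr_sum t ht j S]
  rcases le_total i j with h | h
  · exact key i j h
  · simp_rw [Q_comm t i j]
    exact key j i h

lemma const_le (s β : ℝ) (hβ : 0 < β) (h1 : β ≤ 1) (hs : 2 * β ≤ s) :
    2 * (1 + 1 / (2 * β) + (2 : ℝ) ^ (1 + 2 * β) * (1 / (2 * β))) ≤ 2 ^ (s / 2 + 3) / β := by
  have a : (2 : ℝ) ^ β ≤ 2 ^ (s / 2) := Real.rpow_le_rpow_of_exponent_le (by norm_num) (by linarith)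
  have b : (2 : ℝ) ^ β ≤ 2 := by
    simpa using Real.rpow_le_rpow_of_exponent_le (show (1 : ℝ) ≤ 2 by norm_num) h1
  have c : (1 : ℝ) ≤ 2 ^ β := Real.one_le_rpow (by norm_num) hβ.le
  have d : (2 : ℝ) ^ (1 + 2 * β) = 2 * (2 ^ β) ^ 2 := by
    rw [Real.rpow_add (by norm_num), Real.rpow_one, mul_comm 2 β, Real.rpow_mul (by norm_num),
      Real.rpow_two]
  have e : (2 : ℝ) ^ (s / 2 + 3) = 2 ^ (s / 2) * 8 := by
    rw [Real.rpow_add (by norm_num)]; norm_num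
  rw [d, e]
  generalize (2 : ℝ) ^ β = x at *
  rw [le_div_iff₀ hβ]
  have : 2 * (1 + 1 / (2 * β) + 2 * x ^ 2 * (1 / (2 * β))) * β = 2 * β + 1 + 2 * x ^ 2 := by
    field_simp
  rw [this]
  nlinarith

end KCE

/-- Let `s > 0` and `0 < β ≤ min{s/2, 1}`. Then for all positive integers `i` and `j`,
`∑_{k≥1} (i∧j)^β (1+|i−j|) / ((i∧k)^β (k∧j)^β (1+|i−k|)(1+|k−j|))
  · (w(i,j)/(w(i,k)w(k,j)))^s ≤ 2^{s/2+3}/β`. -/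
theorem key_convolution_estimate_plus (s β : ℝ) (hs : 0 < s) (hβ : 0 < β)
    (hβs : β ≤ min (s / 2) 1) (i j : ℕ+) :
    Summable (fun k : ℕ+ =>
      ((min i j : ℕ+) : ℝ) ^ β * (1 + |(i : ℝ) - (j : ℝ)|) /
          (((min i k : ℕ+) : ℝ) ^ β * ((min k j : ℕ+) : ℝ) ^ β *
            (1 + |(i : ℝ) - (k : ℝ)|) * (1 + |(k : ℝ) - (j : ℝ)|)) *
        (w i j / (w i k * w k j)) ^ s) ∧
    ∑' k : ℕ+,
      ((min i j : ℕ+) : ℝ) ^ β * (1 + |(i : ℝ) - (j : ℝ)|) /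
          (((min i k : ℕ+) : ℝ) ^ β * ((min k j : ℕ+) : ℝ) ^ β *
            (1 + |(i : ℝ) - (k : ℝ)|) * (1 + |(k : ℝ) - (j : ℝ)|)) *
        (w i j / (w i k * w k j)) ^ s ≤ 2 ^ (s / 2 + 3) / β := by
  have hβ1 : β ≤ 1 := hβs.trans (min_le_right _ _)
  have hβ2 : 2 * β ≤ s := by linarith [hβs.trans (min_le_left _ _)]
  have hS : ∀ S : Finset ℕ+, ∑ k ∈ S,
      (((min i j : ℕ+) : ℝ) ^ β * (1 + |(i : ℝ) - (j : ℝ)|) /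
          (((min i k : ℕ+) : ℝ) ^ β * ((min k j : ℕ+) : ℝ) ^ β *
            (1 + |(i : ℝ) - (k : ℝ)|) * (1 + |(k : ℝ) - (j : ℝ)|)) *
        (w i j / (w i k * w k j)) ^ s) ≤ 2 ^ (s / 2 + 3) / β := fun S =>
    (Finset.sum_le_sum fun k _ => KCE.term_le s β hβ2 i j k).trans
      ((KCE.Q_sum (2 * β) (by linarith) i j S).trans (KCE.const_le s β hβ hβ1 hβ2))
  exact ⟨summable_of_sum_le (fun k => KCE.term_nonneg s β i j k) hS,
    Real.tsum_le_of_sum_le (fun k => KCE.term_nonneg s β i j k) hS⟩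
end

section
/- Let s ≥ 0 and 0 ≤ β' < β ≤ 1/2, and let A ∈ M_{s,β}^+. Then A defines a bounded linear map from Y_s to Y_{s+β'} via (Aζ)_i = ∑_{j≥1} A_i^j ζ_j, and ‖Aζ‖_{s+β'} ≤ (2^{s+4}/(β−β')) · |A|_{s,β+} · ‖ζ‖_s for every ζ ∈ Y_s. -/
/-- The dimension `2·d_j` of the `j`-th block. -/
def dim (d : ℕ+ → ℕ+) (j : ℕ+) : ℕ := 2 * d j

namespace MsbAux

lemma schur (L : ℕ+ → ℕ+ → ℝ) (p x : ℕ+ → ℝ) (C : ℝ) (hL : ∀ i j, 0 ≤ L i j)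
    (hsym : ∀ i j, L i j = L j i) (hp : ∀ i, 0 < p i) (hx : ∀ i, 0 ≤ x i) (hC : 0 ≤ C)
    (hrow : ∀ i (T : Finset ℕ+), ∑ j ∈ T, L i j * p j ≤ C * p i)
    (hsum : Summable fun j => x j ^ 2) :
    (∀ i, Summable fun j => L i j * x j) ∧
    ∀ S : Finset ℕ+, ∑ i ∈ S, (∑' j, L i j * x j) ^ 2 ≤ C ^ 2 * ∑' j, x j ^ 2 := by
  have key : ∀ S T : Finset ℕ+, ∑ i ∈ S, (∑ j ∈ T, L i j * x j) ^ 2 ≤ C ^ 2 * ∑' j, x j ^ 2 := by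
    intro S T
    have h1 : ∀ i, (∑ j ∈ T, L i j * x j) ^ 2 ≤ (C * p i) * ∑ j ∈ T, L i j * (x j ^ 2 / p j) := by
      intro i
      refine (Finset.sum_sq_le_sum_mul_sum_of_sq_le_mul T (f := fun j => L i j * p j)
        (g := fun j => L i j * (x j ^ 2 / p j)) ?_ ?_ ?_).trans ?_
      · intro j _; exact mul_nonneg (hL i j) (hp j).le
      · intro j _; exact mul_nonneg (hL i j) (div_nonneg (sq_nonneg _) (hp j).le)
      · intro j _
        have := (hp j).ne'
        refine le_of_eq ?_
        field_simp
      · exact mul_le_mul_of_nonneg_right (hrow i T) (Finset.sum_nonneg fun j _ =>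
          mul_nonneg (hL i j) (div_nonneg (sq_nonneg _) (hp j).le))
    calc ∑ i ∈ S, (∑ j ∈ T, L i j * x j) ^ 2
        ≤ ∑ i ∈ S, (C * p i) * ∑ j ∈ T, L i j * (x j ^ 2 / p j) := Finset.sum_le_sum fun i _ => h1 i
      _ = ∑ j ∈ T, C * (x j ^ 2 / p j) * ∑ i ∈ S, L j i * p i := by
          simp_rw [Finset.mul_sum]
          rw [Finset.sum_comm]
          refine Finset.sum_congr rfl fun j _ => Finset.sum_congr rfl fun i _ => ?_
          rw [hsym i j]; ring
      _ ≤ ∑ j ∈ T, C * (x j ^ 2 / p j) * (C * p j) := by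
          refine Finset.sum_le_sum fun j _ => mul_le_mul_of_nonneg_left (hrow j S) ?_
          exact mul_nonneg hC (div_nonneg (sq_nonneg _) (hp j).le)
      _ = C ^ 2 * ∑ j ∈ T, x j ^ 2 := by
          rw [Finset.mul_sum]
          refine Finset.sum_congr rfl fun j _ => ?_
          have := (hp j).ne'
          field_simp
      _ ≤ C ^ 2 * ∑' j, x j ^ 2 :=
          mul_le_mul_of_nonneg_left (hsum.sum_le_tsum T fun j _ => sq_nonneg _) (sq_nonneg _)
  have hs : ∀ i, Summable fun j => L i j * x j := by
    intro i
    refine summable_of_sum_le (c := Real.sqrt (C ^ 2 * ∑' j, x j ^ 2))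
      (fun j => mul_nonneg (hL i j) (hx j)) fun T => ?_
    have := key {i} T
    rw [Finset.sum_singleton] at this
    exact Real.le_sqrt_of_sq_le this
  refine ⟨hs, fun S => ?_⟩
  refine le_of_tendsto (x := Filter.atTop) (f := fun T : Finset ℕ+ =>
    ∑ i ∈ S, (∑ j ∈ T, L i j * x j) ^ 2) ?_ (Filter.Eventually.of_forall fun T => key S T)
  exact tendsto_finsetSum S fun i _ => (hs i).hasSum.pow 2

noncomputable def F (ε : ℝ) (k : ℕ) : ℝ := (k : ℝ) ^ (-1 - ε)

lemma F_nonneg (ε : ℝ) (k : ℕ) : 0 ≤ F ε k := by unfold F; positivity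

lemma F_step (ε : ℝ) (h0 : 0 < ε) (h1 : ε ≤ 1) (k : ℕ) (hk : 1 ≤ k) :
    F ε (k + 1) ≤ ((k : ℝ) ^ (-ε) - ((k + 1 : ℕ) : ℝ) ^ (-ε)) / ε := by
  have hk0 : (0 : ℝ) < k := by exact_mod_cast hk
  have hk1 : (0 : ℝ) < (k : ℝ) + 1 := by positivity
  unfold F
  push_cast
  rw [le_div_iff₀ h0]
  have hb := rpow_one_add_le_one_add_mul_self (s := -1 / ((k : ℝ) + 1)) (p := ε)
    (by rw [le_div_iff₀ hk1]; linarith) h0.le h1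
  have e1 : 1 + -1 / ((k : ℝ) + 1) = k / (k + 1) := by field_simp; ring
  rw [e1, Real.div_rpow hk0.le hk1.le] at hb
  have e2 : ((k : ℝ) + 1) ^ (-1 - ε) = (1 / (k + 1)) * (1 / ((k : ℝ) + 1) ^ ε) := by
    rw [sub_eq_add_neg, Real.rpow_add hk1, Real.rpow_neg_one, Real.rpow_neg hk1.le]; simp
  rw [e2, Real.rpow_neg hk0.le, Real.rpow_neg hk1.le]
  set a := (k : ℝ) ^ ε
  set b := ((k : ℝ) + 1) ^ ε
  have ha : 0 < a := Real.rpow_pos_of_pos hk0 _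
  have hbp : 0 < b := Real.rpow_pos_of_pos hk1 _
  set t := ε / ((k : ℝ) + 1) with ht
  have ht0 : 0 < t := by positivity
  have hb' : a ≤ (1 - t) * b := by
    rw [div_le_iff₀ hbp] at hb
    calc a ≤ _ := hb
      _ = _ := by rw [ht]; ring
  have h3 : (1 + t) * a ≤ b := by nlinarith [mul_pos ht0 ht0, mul_le_mul_of_nonneg_left hb' (by linarith : 0 ≤ 1 + t)]
  have h4 : 1 / ((k : ℝ) + 1) * (1 / b) * ε = t * (1 / b) := by rw [ht]; ring
  rw [h4]
  have h5 : (1 + t) / b ≤ 1 / a := by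
    rw [div_le_div_iff₀ hbp ha]; linarith
  have h6 : (1 + t) / b = b⁻¹ + t * (1 / b) := by field_simp
  rw [h6] at h5
  simp only [one_div] at h5 ⊢
  linarith

lemma F_range (ε : ℝ) (h0 : 0 < ε) (h1 : ε ≤ 1) (n : ℕ) :
    ∑ k ∈ Finset.range (n + 2), F ε k ≤ 1 + 1 / ε - ((n + 1 : ℕ) : ℝ) ^ (-ε) / ε := by
  induction n with
  | zero =>
    have : (-1 - ε) ≠ 0 := by linarith
    simp [Finset.sum_range_succ, F, Real.zero_rpow this]
  | succ n ih =>
    rw [Finset.sum_range_succ]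
    have := F_step ε h0 h1 (n + 1) (by omega)
    rw [sub_div] at this
    linarith

lemma F_finset (ε : ℝ) (h0 : 0 < ε) (h1 : ε ≤ 1) (T : Finset ℕ) :
    ∑ k ∈ T, F ε k ≤ 1 + 1 / ε := by
  have hsub : T ⊆ Finset.range (T.sup id + 2) := by
    intro k hk
    have : k ≤ T.sup id := Finset.le_sup (f := id) hk
    simp; omega
  refine (Finset.sum_le_sum_of_subset_of_nonneg hsub fun k _ _ => F_nonneg ε k).trans ?_
  refine (F_range ε h0 h1 _).trans ?_
  have : 0 ≤ ((T.sup id + 1 : ℕ) : ℝ) ^ (-ε) / ε := by positivity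
  linarith

lemma F_inj (ε : ℝ) (h0 : 0 < ε) (h1 : ε ≤ 1) (T : Finset ℕ+) (g : ℕ+ → ℕ)
    (hg : Set.InjOn g T) : ∑ j ∈ T, F ε (g j) ≤ 1 + 1 / ε := by
  rw [← Finset.sum_image (f := F ε) hg]
  exact F_finset ε h0 h1 _

/-- the dominating kernel -/
noncomputable def L (ε : ℝ) (i j : ℕ+) : ℝ :=
  (max (i : ℝ) (j : ℝ)) ^ (1 / 2 - ε) * (min (i : ℝ) (j : ℝ)) ^ (-(1 / 2) : ℝ) /
    (1 + |(i : ℝ) - (j : ℝ)|)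

def D (i j : ℕ+) : ℕ := 1 + ((i : ℕ) - (j : ℕ)) + ((j : ℕ) - (i : ℕ))

lemma L_pt (ε : ℝ) (h0 : 0 < ε) (i j : ℕ+) :
    L ε i j * (j : ℝ) ^ (-(1 / 2) : ℝ) ≤ (F ε (D i j) + F ε j) * (i : ℝ) ^ (-(1 / 2) : ℝ) := by
  have hi : (0 : ℝ) < i := by exact_mod_cast i.pos
  have hj : (0 : ℝ) < j := by exact_mod_cast j.pos
  have hi1 : (1 : ℝ) ≤ i := by exact_mod_cast i.one_le
  have hj1 : (1 : ℝ) ≤ j := by exact_mod_cast j.one_le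
  have hF : ∀ r : ℝ, 0 < r → r ^ (-1 - ε) = r ^ (-ε) / r := by
    intro r hr
    rw [show (-1 - ε) = -ε - 1 by ring, Real.rpow_sub_one hr.ne']
  have hip : 0 < (i : ℝ) ^ (-(1 / 2) : ℝ) := Real.rpow_pos_of_pos hi _
  rcases le_or_gt i j with h | h
  · have hr : (i : ℝ) ≤ j := by exact_mod_cast h
    have hD : ((D i j : ℕ) : ℝ) = 1 + (j - i) := by
      have : (i : ℕ) ≤ j := h
      unfold D
      push_cast [Nat.cast_sub this]
      simp [Nat.sub_eq_zero_of_le this]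
    have hDp : (0 : ℝ) < 1 + (j - i) := by linarith
    unfold L
    rw [max_eq_right hr, min_eq_left hr, abs_sub_comm, abs_of_nonneg (by linarith : (0 : ℝ) ≤ j - i)]
    have e : (j : ℝ) ^ (1 / 2 - ε) * (j : ℝ) ^ (-(1 / 2) : ℝ) = (j : ℝ) ^ (-ε) := by
      rw [← Real.rpow_add hj]; ring_nf
    have h2 : (j : ℝ) ^ (-ε) / (1 + (j - i)) ≤ F ε (D i j) := by
      unfold F
      rw [hD, hF _ hDp]
      exact div_le_div_of_nonneg_right
        (Real.rpow_le_rpow_of_nonpos hDp (by linarith) (by linarith)) hDp.le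
    calc _ = ((j : ℝ) ^ (1 / 2 - ε) * (j : ℝ) ^ (-(1 / 2) : ℝ)) / (1 + (j - i)) * (i : ℝ) ^ (-(1 / 2) : ℝ) := by ring
      _ ≤ _ := by
        rw [e]
        exact mul_le_mul_of_nonneg_right (by linarith [F_nonneg ε j]) hip.le
  · have hr : (j : ℝ) ≤ i := by exact_mod_cast h.le
    have hD : ((D i j : ℕ) : ℝ) = 1 + (i - j) := by
      have : (j : ℕ) ≤ i := h.le
      unfold D
      push_cast [Nat.cast_sub this]
      simp [Nat.sub_eq_zero_of_le this]
    have hDp : (0 : ℝ) < 1 + (i - j) := by linarith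
    unfold L
    rw [max_eq_left hr, min_eq_right hr, abs_of_nonneg (by linarith : (0 : ℝ) ≤ i - j)]
    have e : (j : ℝ) ^ (-(1 / 2) : ℝ) * (j : ℝ) ^ (-(1 / 2) : ℝ) = 1 / j := by
      rw [← Real.rpow_add hj, show (-(1 / 2) + -(1 / 2) : ℝ) = -1 by norm_num, Real.rpow_neg_one, one_div]
    have e2 : (i : ℝ) ^ (1 / 2 - ε) = i * (i : ℝ) ^ (-ε) * (i : ℝ) ^ (-(1 / 2) : ℝ) := by
      nth_rewrite 2 [← Real.rpow_one (i : ℝ)]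
      rw [← Real.rpow_add hi, ← Real.rpow_add hi]; ring_nf
    have h2 : (i : ℝ) ^ (-ε) / (1 + (i - j)) ≤ F ε (D i j) := by
      unfold F
      rw [hD, hF _ hDp]
      exact div_le_div_of_nonneg_right
        (Real.rpow_le_rpow_of_nonpos hDp (by linarith) (by linarith)) hDp.le
    have h3 : (i : ℝ) ^ (-ε) / j ≤ F ε j := by
      unfold F
      rw [hF _ hj]
      exact div_le_div_of_nonneg_right
        (Real.rpow_le_rpow_of_nonpos hj hr (by linarith)) hj.le
    have h4 : (i : ℝ) * (1 / j) / (1 + (i - j)) ≤ 1 / (1 + (i - j)) + 1 / j := by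
      rw [div_add_div _ _ hDp.ne' hj.ne', div_le_div_iff₀ hDp (by positivity)]
      field_simp
      linarith
    have hie : 0 < (i : ℝ) ^ (-ε) := Real.rpow_pos_of_pos hi _
    calc _ = (i : ℝ) ^ (1 / 2 - ε) * ((j : ℝ) ^ (-(1 / 2) : ℝ) * (j : ℝ) ^ (-(1 / 2) : ℝ)) / (1 + (i - j)) := by ring
      _ = (i : ℝ) ^ (-ε) * ((i : ℝ) * (1 / j) / (1 + (i - j))) * (i : ℝ) ^ (-(1 / 2) : ℝ) := by
        rw [e, e2]; ring
      _ ≤ (i : ℝ) ^ (-ε) * (1 / (1 + (i - j)) + 1 / j) * (i : ℝ) ^ (-(1 / 2) : ℝ) := by gcongr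
      _ = ((i : ℝ) ^ (-ε) / (1 + (i - j)) + (i : ℝ) ^ (-ε) / j) * (i : ℝ) ^ (-(1 / 2) : ℝ) := by ring
      _ ≤ _ := by gcongr

lemma L_row (ε : ℝ) (h0 : 0 < ε) (h1 : ε ≤ 1) (i : ℕ+) (T : Finset ℕ+) :
    ∑ j ∈ T, L ε i j * (j : ℝ) ^ (-(1 / 2) : ℝ) ≤ (3 * (1 + 1 / ε)) * (i : ℝ) ^ (-(1 / 2) : ℝ) := by
  refine (Finset.sum_le_sum fun j _ => L_pt ε h0 i j).trans ?_
  rw [← Finset.sum_mul, Finset.sum_add_distrib]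
  have hip : 0 ≤ (i : ℝ) ^ (-(1 / 2) : ℝ) := by positivity
  refine mul_le_mul_of_nonneg_right ?_ hip
  have a1 := F_inj ε h0 h1 T (fun j => (j : ℕ)) (fun a _ b _ h => PNat.coe_injective h)
  have a2 := F_inj ε h0 h1 (T.filter (fun j => i ≤ j)) (D i) (by
    intro a ha b hb h
    simp only [Finset.coe_filter, Set.mem_ofPred_eq, ← PNat.coe_le_coe] at ha hb
    unfold D at h
    apply PNat.coe_injective
    omega)
  have a3 := F_inj ε h0 h1 (T.filter (fun j => ¬ i ≤ j)) (D i) (by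
    intro a ha b hb h
    simp only [Finset.coe_filter, Set.mem_ofPred_eq, ← PNat.coe_le_coe] at ha hb
    unfold D at h
    apply PNat.coe_injective
    omega)
  have a4 := Finset.sum_filter_add_sum_filter_not T (fun j => i ≤ j) (fun j => F ε (D i j))
  linarith

lemma le_w (i j : ℕ+) : (i : ℝ) ≤ w i j * j := by
  have hi1 : (1 : ℝ) ≤ i := by exact_mod_cast i.one_le
  have hj1 : (1 : ℝ) ≤ j := by exact_mod_cast j.one_le
  have hm : (1 : ℝ) ≤ min (i : ℝ) j := le_min hi1 hj1
  have hs : 1 ≤ Real.sqrt (min (i : ℝ) j) := Real.one_le_sqrt.mpr hm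
  have hss : Real.sqrt (min (i : ℝ) j) * Real.sqrt (min (i : ℝ) j) = min (i : ℝ) j :=
    Real.mul_self_sqrt (by linarith)
  unfold w
  rw [div_mul_eq_mul_div, le_div_iff₀ (by linarith)]
  rcases le_total (i : ℝ) j with h | h
  · have := abs_nonneg ((i : ℝ) - j)
    nlinarith
  · rw [min_eq_right h] at *
    rw [abs_of_nonneg (by linarith)]
    set q := Real.sqrt (j : ℝ)
    have hqj : q ≤ j := by nlinarith
    nlinarith [mul_nonneg (sub_nonneg.mpr h) (sub_nonneg.mpr hqj)]

lemma w_pos (i j : ℕ+) : 0 < w i j := by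
  have hi : (0 : ℝ) < i := by exact_mod_cast i.pos
  have hj : (0 : ℝ) < j := by exact_mod_cast j.pos
  have := le_w i j
  exact pos_of_mul_pos_left (lt_of_lt_of_le hi this) hj.le

lemma ptA (s β β' : ℝ) (hs : 0 ≤ s) (hβ'0 : 0 ≤ β')
    (hβ : β ≤ 1 / 2) (i j : ℕ+) (a M : ℝ) (ha : 0 ≤ a)
    (hA : ((min i j : ℕ+) : ℝ) ^ β * w i j ^ s * (1 + |(i : ℝ) - (j : ℝ)|) * a ≤ M) :
    a * (i : ℝ) ^ (s + β') ≤ M * L (β - β') i j * (j : ℝ) ^ s := by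
  have hi : (0 : ℝ) < i := by exact_mod_cast i.pos
  have hj : (0 : ℝ) < j := by exact_mod_cast j.pos
  have hmc : ((min i j : ℕ+) : ℝ) = min (i : ℝ) j := by
    rcases le_total i j with h | h
    · rw [min_eq_left h, min_eq_left]; exact_mod_cast h
    · rw [min_eq_right h, min_eq_right]; exact_mod_cast h
  rw [hmc] at hA
  unfold L
  have hm : 0 < min (i : ℝ) j := lt_min hi hj
  have hX : 0 < max (i : ℝ) j := lt_max_of_lt_left hi
  have hle : min (i : ℝ) j ≤ max (i : ℝ) j := min_le_max
  have hiX : (i : ℝ) ≤ max (i : ℝ) j := le_max_left _ _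
  set m := min (i : ℝ) j
  set X := max (i : ℝ) j
  have hW := w_pos i j
  have b1 : (i : ℝ) ^ s ≤ w i j ^ s * (j : ℝ) ^ s := by
    rw [← Real.mul_rpow hW.le hj.le]
    exact Real.rpow_le_rpow hi.le (le_w i j) hs
  have b2 : (i : ℝ) ^ β' ≤ m ^ β * (X ^ (1 / 2 - (β - β')) * m ^ (-(1 / 2) : ℝ)) := by
    calc (i : ℝ) ^ β' ≤ X ^ β' := Real.rpow_le_rpow hi.le hiX hβ'0
      _ = X ^ (1 / 2 - (β - β')) * X ^ (β - 1 / 2) := by rw [← Real.rpow_add hX]; ring_nf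
      _ ≤ X ^ (1 / 2 - (β - β')) * m ^ (β - 1 / 2) := by
        refine mul_le_mul_of_nonneg_left ?_ (by positivity)
        exact Real.rpow_le_rpow_of_nonpos hm hle (by linarith)
      _ = _ := by
        rw [sub_eq_add_neg β (1 / 2), Real.rpow_add hm]; ring
  have hDp : 0 < 1 + |(i : ℝ) - j| := by positivity
  set E := 1 + |(i : ℝ) - j|
  set P := X ^ (1 / 2 - (β - β')) * m ^ (-(1 / 2) : ℝ)
  have hP : 0 ≤ P := by positivity
  rw [Real.rpow_add hi]
  have : a * ((i : ℝ) ^ s * (i : ℝ) ^ β') ≤ a * ((w i j ^ s * (j : ℝ) ^ s) * (m ^ β * P)) := by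
    gcongr
  refine this.trans ?_
  calc a * ((w i j ^ s * (j : ℝ) ^ s) * (m ^ β * P))
      = (m ^ β * w i j ^ s * E * a) * (P / E * (j : ℝ) ^ s) := by field_simp
    _ ≤ M * (P / E * (j : ℝ) ^ s) := mul_le_mul_of_nonneg_right hA (by positivity)
    _ = _ := by ring

end MsbAux

/-- Let `s ≥ 0`, `0 ≤ β' < β ≤ 1/2`, and let `A ∈ M_{s,β}^+`, i.e. its blocks
(viewed as operators `ℂ^{2d_j} → ℂ^{2d_i}` with the `ℓ²`-operator norm) satisfy
`(i∧j)^β w(i,j)^s (1+|i−j|) ‖A_i^j‖ ≤ M = |A|_{s,β+}`.  Then for every `ζ ∈ Y_s`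
(i.e. `∑_j |ζ_j|² j^{2s} < ∞`), the sequence `(Aζ)_i = ∑_j A_i^j ζ_j` is well defined,
belongs to `Y_{s+β'}`, and `‖Aζ‖_{s+β'} ≤ (2^{s+4}/(β−β'))·|A|_{s,β+}·‖ζ‖_s`. -/
theorem Msβplus_maps_Ys_to_Ysβ' (s β β' : ℝ) (hs : 0 ≤ s) (hβ'0 : 0 ≤ β') (hβ'β : β' < β)
    (hβ : β ≤ 1 / 2) (d : ℕ+ → ℕ+)
    (A : ∀ i j : ℕ+,
      EuclideanSpace ℂ (Fin (dim d j)) →L[ℂ] EuclideanSpace ℂ (Fin (dim d i)))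
    (M : ℝ)
    (hA : ∀ i j : ℕ+, ((min i j : ℕ+) : ℝ) ^ β * w i j ^ s * (1 + |(i : ℝ) - (j : ℝ)|) *
      ‖A i j‖ ≤ M)
    (ζ : ∀ j : ℕ+, EuclideanSpace ℂ (Fin (dim d j)))
    (hζ : Summable fun j : ℕ+ => ‖ζ j‖ ^ 2 * (j : ℝ) ^ (2 * s)) :
    (∀ i : ℕ+, Summable fun j : ℕ+ => A i j (ζ j)) ∧
    Summable (fun i : ℕ+ => ‖∑' j : ℕ+, A i j (ζ j)‖ ^ 2 * (i : ℝ) ^ (2 * (s + β'))) ∧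
    Real.sqrt (∑' i : ℕ+, ‖∑' j : ℕ+, A i j (ζ j)‖ ^ 2 * (i : ℝ) ^ (2 * (s + β'))) ≤
      2 ^ (s + 4) / (β - β') * M *
        Real.sqrt (∑' j : ℕ+, ‖ζ j‖ ^ 2 * (j : ℝ) ^ (2 * s)) := by
  have hε : 0 < β - β' := by linarith
  have hε2 : β - β' ≤ 1 / 2 := by linarith
  set ε := β - β' with hεd
  have hM : 0 ≤ M := by
    refine le_trans ?_ (hA 1 1)
    have := MsbAux.w_pos 1 1
    positivity
  set x : ℕ+ → ℝ := fun j => ‖ζ j‖ * (j : ℝ) ^ s with hxd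
  have hpos : ∀ j : ℕ+, (0 : ℝ) < j := fun j => by exact_mod_cast j.pos
  have hsq : ∀ (r t : ℝ) (j : ℕ+), r ^ 2 * (j : ℝ) ^ (2 * t) = (r * (j : ℝ) ^ t) ^ 2 := by
    intro r t j
    rw [mul_pow, mul_comm 2 t, Real.rpow_mul (hpos j).le]
    norm_cast
  simp_rw [hsq] at hζ ⊢
  change Summable fun j => x j ^ 2 at hζ
  change _ ∧ _ ∧ _ ≤ _ * Real.sqrt (∑' j, x j ^ 2)
  have hC : 0 ≤ 3 * (1 + 1 / ε) := by positivity
  have hL0 : ∀ i j, 0 ≤ MsbAux.L ε i j := fun i j => by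
    have := hpos i
    have := hpos j
    unfold MsbAux.L
    positivity
  obtain ⟨h1, h2⟩ := MsbAux.schur (MsbAux.L ε) (fun j => (j : ℝ) ^ (-(1 / 2) : ℝ)) x
    (3 * (1 + 1 / ε)) hL0
    (fun i j => by unfold MsbAux.L; rw [max_comm, min_comm, abs_sub_comm])
    (fun j => Real.rpow_pos_of_pos (hpos j) _)
    (fun j => by simp only [hxd]; positivity) hC
    (fun i T => MsbAux.L_row ε hε (by linarith) i T) hζ
  have hb : ∀ i j, ‖A i j (ζ j)‖ * (i : ℝ) ^ (s + β') ≤ M * (MsbAux.L ε i j * x j) := by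
    intro i j
    have := MsbAux.ptA s β β' hs hβ'0 hβ i j ‖A i j‖ M (norm_nonneg _) (hA i j)
    calc ‖A i j (ζ j)‖ * (i : ℝ) ^ (s + β') ≤ (‖A i j‖ * ‖ζ j‖) * (i : ℝ) ^ (s + β') := by
          gcongr
          exact (A i j).le_opNorm _
      _ = (‖A i j‖ * (i : ℝ) ^ (s + β')) * ‖ζ j‖ := by ring
      _ ≤ (M * MsbAux.L ε i j * (j : ℝ) ^ s) * ‖ζ j‖ := by gcongr
      _ = _ := by simp only [hxd]; ring
  have hn : ∀ i, Summable fun j => ‖A i j (ζ j)‖ := by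
    intro i
    have hip : 0 < (i : ℝ) ^ (s + β') := Real.rpow_pos_of_pos (hpos i) _
    have : Summable fun j => ‖A i j (ζ j)‖ * (i : ℝ) ^ (s + β') :=
      Summable.of_nonneg_of_le (fun j => by positivity) (hb i) ((h1 i).mul_left M)
    exact (summable_mul_right_iff hip.ne').mp this
  have hq : ∀ i, ‖∑' j : ℕ+, A i j (ζ j)‖ * (i : ℝ) ^ (s + β') ≤
      M * ∑' j, MsbAux.L ε i j * x j := by
    intro i
    calc _ ≤ (∑' j, ‖A i j (ζ j)‖) * (i : ℝ) ^ (s + β') := by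
          gcongr
          exact norm_tsum_le_tsum_norm (hn i)
      _ = ∑' j, ‖A i j (ζ j)‖ * (i : ℝ) ^ (s + β') := tsum_mul_right.symm
      _ ≤ ∑' j, M * (MsbAux.L ε i j * x j) :=
          ((hn i).mul_right _).tsum_le_tsum (hb i) ((h1 i).mul_left M)
      _ = _ := tsum_mul_left
  have hS : ∀ S : Finset ℕ+, ∑ i ∈ S, (‖∑' j : ℕ+, A i j (ζ j)‖ * (i : ℝ) ^ (s + β')) ^ 2 ≤
      (M * (3 * (1 + 1 / ε))) ^ 2 * ∑' j, x j ^ 2 := by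
    intro S
    calc _ ≤ ∑ i ∈ S, (M * ∑' j, MsbAux.L ε i j * x j) ^ 2 :=
          Finset.sum_le_sum fun i _ => pow_le_pow_left₀ (by positivity) (hq i) 2
      _ = M ^ 2 * ∑ i ∈ S, (∑' j, MsbAux.L ε i j * x j) ^ 2 := by
          rw [Finset.mul_sum]
          exact Finset.sum_congr rfl fun i _ => mul_pow _ _ _
      _ ≤ M ^ 2 * ((3 * (1 + 1 / ε)) ^ 2 * ∑' j, x j ^ 2) :=
          mul_le_mul_of_nonneg_left (h2 S) (sq_nonneg _)
      _ = _ := by ring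
  have hsum := summable_of_sum_le (fun i => sq_nonneg _) hS
  refine ⟨fun i => (hn i).of_norm, hsum, ?_⟩
  have hT := hsum.tsum_le_of_sum_le hS
  refine (Real.sqrt_le_sqrt hT).trans ?_
  rw [Real.sqrt_mul (sq_nonneg _), Real.sqrt_sq (by positivity)]
  refine mul_le_mul_of_nonneg_right ?_ (Real.sqrt_nonneg _)
  rw [mul_comm M]
  refine mul_le_mul_of_nonneg_right ?_ hM
  have h16 : (16 : ℝ) ≤ 2 ^ (s + 4) := by
    calc (16 : ℝ) = 2 ^ (4 : ℝ) := by norm_num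
      _ ≤ _ := Real.rpow_le_rpow_of_exponent_le (by norm_num) (by linarith)
  rw [le_div_iff₀ hε]
  have : 3 * (1 + 1 / ε) * ε = 3 * ε + 3 := by field_simp
  rw [this]
  linarith
end
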